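/- arXiv:2411.06555 — 2 statements merged into one kernel-verified Lean document; each statement's English description precedes it below -/
import Mathlib

section
/- Let p ∈ [1, ∞), let 𝒟 be a dyadic lattice in ℝⁿ, let λ_Q ≥ 0 be given for each Q ∈ 𝒟, and let ω be a weight. Then ‖Σ_{Q∈𝒟} λ_Q χ_Q‖_{L^p(ω)} is comparable, with constants depending only on p, to ( Σ_{Q∈𝒟} λ_Q ( ω(Q)^{-1} Σ_{Q′∈𝒟, Q′⊂Q} λ_{Q′} ω(Q′) )^{p−1} ω(Q) )^{1/p}. -/
open MeasureTheory Set ENNReal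

noncomputable section

namespace Frac

/-- A half-open cube in `ℝⁿ`, given by its center and half-sidelength. -/
structure Cube (n : ℕ) where
  c : Fin n → ℝ
  h : ℝ
  h_pos : 0 < h

namespace Cube

variable {n : ℕ}

/-- The underlying (half-open) set of a cube. -/
def set (Q : Cube n) : Set (Fin n → ℝ) :=
  {y | ∀ i, Q.c i - Q.h ≤ y i ∧ y i < Q.c i + Q.h}

/-- The concentric dilate `3Q`. -/
def three (Q : Cube n) : Cube n :=
  ⟨Q.c, 3 * Q.h, by have := Q.h_pos; linarith⟩

/-- The sidelength `ℓ(Q)`. -/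
def side (Q : Cube n) : ℝ := 2 * Q.h

/-- The volume `|Q|` of a cube. -/
def vol (Q : Cube n) : ℝ≥0∞ := volume Q.set

/-- One of the `2ⁿ` dyadic children of a cube. -/
def child (Q : Cube n) (ε : Fin n → Bool) : Cube n :=
  ⟨fun i => Q.c i + (if ε i then Q.h / 2 else -(Q.h / 2)), Q.h / 2, by
    have := Q.h_pos; linarith⟩

/-- The normalized restriction of Lebesgue measure to a cube. -/
def nmeas (Q : Cube n) : Measure (Fin n → ℝ) := (Q.vol)⁻¹ • volume.restrict Q.set

end Cube

variable {n : ℕ}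

/-- `R` is a dyadic child of `Q`. -/
def childRel (Q R : Cube n) : Prop := ∃ ε, R = Q.child ε

/-- `R` is a dyadic descendant of `Q` (possibly `Q` itself). -/
def descendant (Q R : Cube n) : Prop := Relation.ReflTransGen childRel Q R

/-- A dyadic lattice in `ℝⁿ`. -/
structure IsDyadicLattice (D : Set (Cube n)) : Prop where
  mem_of_descendant : ∀ Q ∈ D, ∀ R : Cube n, descendant Q R → R ∈ D
  common_ancestor : ∀ Q ∈ D, ∀ Q' ∈ D, ∃ R ∈ D, descendant R Q ∧ descendant R Q'
  exists_contains : ∀ K : Set (Fin n → ℝ), IsCompact K → ∃ Q ∈ D, K ⊆ Q.set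

/-- An `η`-sparse family of cubes. -/
def IsSparse (η : ℝ) (S : Set (Cube n)) : Prop :=
  ∃ E : Cube n → Set (Fin n → ℝ),
    (∀ Q ∈ S, MeasurableSet (E Q) ∧ E Q ⊆ Q.set ∧ ENNReal.ofReal η * Q.vol ≤ volume (E Q)) ∧
    (∀ Q ∈ S, ∀ Q' ∈ S, Q ≠ Q' → Disjoint (E Q) (E Q'))

/-- The average `⟨f⟩_{r,Q} = (|Q|⁻¹∫_Q |f|^r)^{1/r}`, with the `essSup` interpretation
for `r = ∞`. -/
def avg (r : ℝ≥0∞) (Q : Cube n) (f : (Fin n → ℝ) → ℝ) : ℝ≥0∞ :=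
  eLpNorm f r Q.nmeas

/-- The (real-valued) average `⟨b⟩_Q`. -/
def avgR (Q : Cube n) (b : (Fin n → ℝ) → ℝ) : ℝ :=
  (∫ y in Q.set, b y) / (Q.vol).toReal

/-- The oscillation `osc_s(h; Q)`. -/
def osc (s : ℝ≥0∞) (Q : Cube n) (h : (Fin n → ℝ) → ℝ) : ℝ≥0∞ :=
  eLpNorm (fun p : ((Fin n → ℝ) × (Fin n → ℝ)) => h p.1 - h p.2) s (Q.nmeas.prod Q.nmeas)

/-- The sharp grand maximal truncation operator `𝓜^#_{T,s}`. -/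
def Msharp (T : ((Fin n → ℝ) → ℝ) → ((Fin n → ℝ) → ℝ)) (s : ℝ≥0∞)
    (f : (Fin n → ℝ) → ℝ) (x : Fin n → ℝ) : ℝ≥0∞ :=
  ⨆ (Q : Cube n) (_ : x ∈ Q.set), osc s Q (T ((Q.three.set)ᶜ.indicator f))

/-- `T` is a sublinear operator. -/
def Sublinear (T : ((Fin n → ℝ) → ℝ) → ((Fin n → ℝ) → ℝ)) : Prop :=
  (∀ f g : (Fin n → ℝ) → ℝ, ∀ᵐ x : Fin n → ℝ, |T (f + g) x| ≤ |T f x| + |T g x|) ∧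
  (∀ (c : ℝ) (f : (Fin n → ℝ) → ℝ), ∀ᵐ x : Fin n → ℝ, |T (fun y => c * f y) x| = |c| * |T f x|)

/-- Locally weak `L^{p₀} → L^{p₀ n/(n - a p₀)}` boundedness of an (`ℝ≥0∞`-valued)
operator `U`, with associated non-increasing function `φ : (0,1) → [0,∞)`. -/
def LocWeak (n : ℕ) (p₀ a : ℝ)
    (U : ((Fin n → ℝ) → ℝ) → ((Fin n → ℝ) → ℝ≥0∞)) (φ : ℝ → ℝ) : Prop :=
  (∀ t ∈ Ioo (0 : ℝ) 1, 0 ≤ φ t) ∧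
  (∀ t ∈ Ioo (0 : ℝ) 1, ∀ t' ∈ Ioo (0 : ℝ) 1, t ≤ t' → φ t' ≤ φ t) ∧
  ∀ (Q : Cube n) (f : (Fin n → ℝ) → ℝ),
    avg (ENNReal.ofReal p₀) Q (Q.set.indicator f) < ∞ →
    ∀ t ∈ Ioo (0 : ℝ) 1,
      volume {x ∈ Q.set |
          ENNReal.ofReal (φ t) * avg (ENNReal.ofReal p₀) Q (Q.set.indicator f) *
              Q.vol ^ (a / n) < U (Q.set.indicator f) x}
        ≤ ENNReal.ofReal t * Q.vol

/-- `|T f|`, viewed as an `ℝ≥0∞`-valued operator. -/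
def eabs (T : ((Fin n → ℝ) → ℝ) → ((Fin n → ℝ) → ℝ)) :
    ((Fin n → ℝ) → ℝ) → ((Fin n → ℝ) → ℝ≥0∞) :=
  fun f x => ENNReal.ofReal |T f x|

/-- The iterated commutator `T_b^m f (x) = T ((b(x) - b(·))^m f)(x)` (so `T_b^0 = T`). -/
def comm (T : ((Fin n → ℝ) → ℝ) → ((Fin n → ℝ) → ℝ))
    (b : (Fin n → ℝ) → ℝ) (m : ℕ) (f : (Fin n → ℝ) → ℝ) : (Fin n → ℝ) → ℝ :=
  fun x => T (fun y => (b x - b y) ^ m * f y) x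

/-- `w(Q) = ∫_Q w` for a weight `w`. -/
def wInt (w : (Fin n → ℝ) → ℝ) (Q : Cube n) : ℝ≥0∞ :=
  ∫⁻ y in Q.set, ENNReal.ofReal (w y)

/-- The weighted norm `‖f‖_{L^p(w)}`, `p ∈ (0,∞]`. -/
def wNorm (p : ℝ≥0∞) (w : (Fin n → ℝ) → ℝ) (f : (Fin n → ℝ) → ℝ) : ℝ≥0∞ :=
  eLpNorm f p (volume.withDensity fun x => ENNReal.ofReal (w x))

/-- The weighted `L^p`-norm of an `ℝ≥0∞`-valued function. -/
def wNormE (p : ℝ) (w : (Fin n → ℝ) → ℝ) (g : (Fin n → ℝ) → ℝ≥0∞) : ℝ≥0∞ :=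
  (∫⁻ x, g x ^ p * ENNReal.ofReal (w x)) ^ (1 / p)

/-- The Hardy–Littlewood maximal operator of an `ℝ≥0∞`-valued function. -/
def emax (g : (Fin n → ℝ) → ℝ≥0∞) (x : Fin n → ℝ) : ℝ≥0∞ :=
  ⨆ (Q : Cube n) (_ : x ∈ Q.set), (Q.vol)⁻¹ * ∫⁻ y in Q.set, g y

/-- The Fujii–Wilson `A_∞` constant `[w]_{A_∞}`. -/
def Ainf (w : (Fin n → ℝ) → ℝ) : ℝ≥0∞ :=
  ⨆ Q : Cube n,
    (wInt w Q)⁻¹ *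
      ∫⁻ x in Q.set, emax (Q.set.indicator fun y => ENNReal.ofReal (w y)) x

/-- The Muckenhoupt constant `[w]_{A_t}`. -/
def Amuck (t : ℝ) (w : (Fin n → ℝ) → ℝ) : ℝ≥0∞ :=
  ⨆ Q : Cube n,
    ((Q.vol)⁻¹ * wInt w Q) *
      ((Q.vol)⁻¹ * wInt (fun x => w x ^ ((1 : ℝ) - t / (t - 1))) Q) ^ (t - 1)

/-- The reverse Hölder constant `[w]_{RH_r}`. -/
def RHconst (r : ℝ) (w : (Fin n → ℝ) → ℝ) : ℝ≥0∞ :=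
  ⨆ Q : Cube n, avg (ENNReal.ofReal r) Q w / ((Q.vol)⁻¹ * wInt w Q)

/-- The two-weight constant `[w,σ]_{A^a_{β,γ}} = sup_Q |Q|^a w(Q)^β σ(Q)^γ`. -/
def A2 (a β γ : ℝ) (w σ : (Fin n → ℝ) → ℝ) : ℝ≥0∞ :=
  ⨆ Q : Cube n, Q.vol ^ a * wInt w Q ^ β * wInt σ Q ^ γ

/-- The Bloom weighted BMO seminorm `‖b‖_{BMO_ν}`. -/
def bmoW (ν b : (Fin n → ℝ) → ℝ) : ℝ≥0∞ :=
  ⨆ Q : Cube n, (wInt ν Q)⁻¹ * ∫⁻ x in Q.set, ENNReal.ofReal |b x - avgR Q b|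

/-- The BMO seminorm `‖b‖_{BMO}`. -/
def bmo (b : (Fin n → ℝ) → ℝ) : ℝ≥0∞ :=
  ⨆ Q : Cube n, (Q.vol)⁻¹ * ∫⁻ x in Q.set, ENNReal.ofReal |b x - avgR Q b|

/-- The conjugate exponent of `q ∈ [1,∞]`, as a real number (`1` when `q = ∞`). -/
def econjR (q : ℝ≥0∞) : ℝ := if q = ∞ then 1 else q.toReal / (q.toReal - 1)

/-- The conjugate exponent of `q ∈ [1,∞]`, as an element of `[1,∞]`. -/
def econj (q : ℝ≥0∞) : ℝ≥0∞ := if q = ∞ then 1 else ENNReal.ofReal (econjR q)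

/-- The conjugate exponent of a real `q ≥ 1`, as an element of `[1,∞]` (`∞` when `q = 1`). -/
def rconj (q : ℝ) : ℝ≥0∞ := if q = 1 then ∞ else ENNReal.ofReal (q / (q - 1))

/-- `1/q`, for `q ∈ (0,∞]` (`0` when `q = ∞`). -/
def invE (q : ℝ≥0∞) : ℝ := if q = ∞ then 0 else 1 / q.toReal

end Frac

namespace Frac

set_option linter.unusedSectionVars false
set_option linter.unusedVariables false
set_option linter.unusedSimpArgs false

lemma real_bernU {p x a : ℝ} (hp : 1 ≤ p) (hx : 0 ≤ x) (ha : 0 ≤ a) :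
    (x + a) ^ p ≤ x ^ p + p * (a * (x + a) ^ (p - 1)) := by
  rcases (add_nonneg hx ha).eq_or_lt with h | h
  · rw [← h, Real.zero_rpow (by linarith)]
    positivity
  · have hb := one_add_mul_self_le_rpow_one_add (s := -(a / (x + a)))
      (by rw [neg_le_neg_iff, div_le_one h]; linarith) hp
    have h1 : 1 + -(a / (x + a)) = x / (x + a) := by field_simp; ring
    rw [h1, Real.div_rpow hx h.le] at hb
    have hpos : 0 < (x + a) ^ p := Real.rpow_pos_of_pos h p
    rw [le_div_iff₀ hpos] at hb
    have h2 : (x + a) ^ p = (x + a) ^ (p - 1) * (x + a) := by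
      rw [← Real.rpow_add_one h.ne']; congr 1; ring
    have h3 : (1 + p * -(a / (x + a))) * (x + a) ^ p
        = (x + a) ^ p - p * (a * (x + a) ^ (p - 1)) := by
      rw [h2]; field_simp; ring
    linarith

lemma real_bernL {q x a : ℝ} (hq : 0 < q) (hq1 : q ≤ 1) (hx : 0 ≤ x) (ha : 0 ≤ a)
    (h : 0 < x + a) :
    q * (a * (x + a) ^ (q - 1)) + x ^ q ≤ (x + a) ^ q := by
  have hb := rpow_one_add_le_one_add_mul_self (s := -(a / (x + a)))
      (by rw [neg_le_neg_iff, div_le_one h]; linarith) hq.le hq1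
  have h1 : 1 + -(a / (x + a)) = x / (x + a) := by field_simp; ring
  rw [h1, Real.div_rpow hx h.le] at hb
  have hpos : 0 < (x + a) ^ q := Real.rpow_pos_of_pos h q
  rw [div_le_iff₀ hpos] at hb
  have h2 : (x + a) ^ q = (x + a) ^ (q - 1) * (x + a) := by
    rw [← Real.rpow_add_one h.ne']; congr 1; ring
  have h3 : (1 + q * -(a / (x + a))) * (x + a) ^ q
      = (x + a) ^ q - q * (a * (x + a) ^ (q - 1)) := by
    rw [h2]; field_simp; ring
  linarith

lemma bernU {p : ℝ} (hp : 1 ≤ p) {x a : ℝ≥0∞} (hx : x ≠ ∞) (ha : a ≠ ∞) :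
    (x + a) ^ p ≤ x ^ p + ENNReal.ofReal p * (a * (x + a) ^ (p - 1)) := by
  have h := real_bernU hp (ENNReal.toReal_nonneg (a := x)) (ENNReal.toReal_nonneg (a := a))
  have h' := ENNReal.ofReal_le_ofReal h
  rw [ENNReal.ofReal_add (by positivity) (by positivity), ENNReal.ofReal_mul (by linarith),
    ENNReal.ofReal_mul (by positivity), ← ENNReal.toReal_add hx ha,
    ENNReal.toReal_rpow, ENNReal.toReal_rpow, ENNReal.toReal_rpow,
    ENNReal.ofReal_toReal (by finiteness),
    ENNReal.ofReal_toReal (by finiteness), ENNReal.ofReal_toReal (by finiteness),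
    ENNReal.ofReal_toReal (ENNReal.rpow_ne_top_of_nonneg (by linarith) (by finiteness))] at h'
  exact h'

lemma bernL {q : ℝ} (hq : 0 < q) (hq1 : q ≤ 1) {x a : ℝ≥0∞} (hx : x ≠ ∞) (ha : a ≠ ∞) :
    ENNReal.ofReal q * (a * (x + a) ^ (q - 1)) + x ^ q ≤ (x + a) ^ q := by
  rcases eq_or_ne (x + a) 0 with h0 | h0
  · obtain ⟨rfl, rfl⟩ := add_eq_zero.1 h0
    simp
  have hpos : 0 < x.toReal + a.toReal := by
    rw [← ENNReal.toReal_add hx ha]; exact ENNReal.toReal_pos h0 (by finiteness)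
  have h := real_bernL hq hq1 (ENNReal.toReal_nonneg (a := x))
    (ENNReal.toReal_nonneg (a := a)) hpos
  have h' := ENNReal.ofReal_le_ofReal h
  rw [ENNReal.ofReal_add (by positivity) (by positivity), ENNReal.ofReal_mul (by linarith),
    ENNReal.ofReal_mul (by positivity), ← ENNReal.toReal_add hx ha,
    ENNReal.toReal_rpow, ENNReal.toReal_rpow, ENNReal.toReal_rpow,
    ENNReal.ofReal_toReal (by finiteness),
    ENNReal.ofReal_toReal (ENNReal.rpow_ne_top_of_ne_zero h0 (by finiteness)),
    ENNReal.ofReal_toReal (by finiteness), ENNReal.ofReal_toReal (by finiteness)] at h'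
  exact h'

lemma rpow_anti {z : ℝ} (hz : z ≤ 0) {x y : ℝ≥0∞} (h : x ≤ y) : y ^ z ≤ x ^ z := by
  obtain ⟨w, rfl⟩ : ∃ w, z = -w := ⟨-z, by ring⟩
  rw [ENNReal.rpow_neg, ENNReal.rpow_neg, ENNReal.inv_le_inv]
  exact ENNReal.rpow_le_rpow h (by linarith)

lemma splitZ {q : ℝ} (hq : 0 ≤ q) (hq1 : q ≤ 1) (u v : ℝ≥0∞) :
    u ^ q ≤ v ^ q + v ^ (q - 1) * u := by
  rcases le_total u v with h | h
  · exact (ENNReal.rpow_le_rpow h hq).trans le_self_add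
  · rcases eq_or_ne u 0 with rfl | hu
    · obtain rfl : v = 0 := by simpa using h
      exact le_self_add
    rcases eq_or_ne u ∞ with rfl | hu'
    · rcases eq_or_ne v ∞ with rfl | hv
      · exact le_self_add
      · have : v ^ (q - 1) ≠ 0 := by
          rw [Ne, ENNReal.rpow_eq_zero_iff]; rintro (⟨_, h⟩ | ⟨h, _⟩)
          · linarith
          · exact hv h
        rw [ENNReal.mul_top this]; simp
    have : u ^ q = u ^ (q - 1) * u := by
      conv_rhs => rw [← ENNReal.rpow_one u, ← ENNReal.rpow_mul, ← ENNReal.rpow_add _ _ hu hu']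
      congr 1; ring
    rw [this]
    refine le_trans ?_ le_add_self
    exact mul_le_mul_left (rpow_anti (by linarith) h) _

lemma splitY {q : ℝ} (hq : 1 ≤ q) {ε : ℝ≥0∞} (h0 : ε ≠ 0) (h1 : ε ≠ ∞) (u v : ℝ≥0∞) :
    u ^ (q - 1) * v ≤ ε * u ^ q + (ε⁻¹) ^ (q - 1) * v ^ q := by
  have key : ∀ w : ℝ≥0∞, w ^ q = w ^ (q - 1) * w := by
    intro w
    conv_rhs => rw [← ENNReal.rpow_one w, ← ENNReal.rpow_mul,
      ← ENNReal.rpow_add_of_nonneg _ _ (by linarith) (by linarith)]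
    congr 1; ring
  rcases le_total v (ε * u) with h | h
  · refine le_trans ?_ le_self_add
    rw [key]
    calc _ ≤ u ^ (q - 1) * (ε * u) := by gcongr
      _ = _ := by ring
  · refine le_trans ?_ le_add_self
    rw [key, ← mul_assoc, ← ENNReal.mul_rpow_of_nonneg _ _ (by linarith)]
    gcongr
    calc u = ε⁻¹ * (ε * u) := by rw [← mul_assoc, ENNReal.inv_mul_cancel h0 h1, one_mul]
      _ ≤ _ := by gcongr

section chain
variable {ι : Type*} (r : ι → ι → Prop) 

lemma exists_max (hr : ∀ i, r i i) (ht : ∀ i j k, r i j → r j k → r i k)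
    (t : Finset ι) (hne : t.Nonempty)
    (tot : ∀ i ∈ t, ∀ j ∈ t, r i j ∨ r j i) : ∃ m ∈ t, ∀ j ∈ t, r j m := by
  induction hne using Finset.Nonempty.cons_induction with
  | singleton a => exact ⟨a, by simp, by simpa using hr a⟩
  | cons a s h hs ih =>
    obtain ⟨m, hm, hmax⟩ := ih fun i hi j hj => tot i (by simp [hi]) j (by simp [hj])
    rcases tot a (by simp) m (by simp [hm]) with h1 | h1
    · refine ⟨m, by simp [hm], fun j hj => ?_⟩
      rcases Finset.mem_cons.1 hj with rfl | hj
      · exact h1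
      · exact hmax j hj
    · refine ⟨a, by simp, fun j hj => ?_⟩
      rcases Finset.mem_cons.1 hj with rfl | hj
      · exact hr _
      · exact ht _ _ _ (hmax j hj) h1

open Classical in
lemma chainU (hr : ∀ i, r i i) (htr : ∀ i j k, r i j → r j k → r i k)
    {p : ℝ} (hp : 1 ≤ p) (a : ι → ℝ≥0∞) (ha : ∀ i, a i ≠ ∞)
    (t : Finset ι) (tot : ∀ i ∈ t, ∀ j ∈ t, r i j ∨ r j i) :
    (∑ i ∈ t, a i) ^ p ≤
      ENNReal.ofReal p * ∑ i ∈ t, a i * (∑ j ∈ t with r j i, a j) ^ (p - 1) := by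
  induction t using Finset.strongInduction with
  | H t ih =>
    rcases t.eq_empty_or_nonempty with rfl | hne
    · simp; linarith
    obtain ⟨m, hm, hmax⟩ := exists_max r hr htr t hne tot
    have ih' := ih (t.erase m) (Finset.erase_ssubset hm)
      fun i hi j hj => tot i (Finset.mem_of_mem_erase hi) j (Finset.mem_of_mem_erase hj)
    have hall : ∑ j ∈ t with r j m, a j = ∑ j ∈ t, a j := by
      rw [Finset.filter_true_of_mem hmax]
    rw [← Finset.sum_erase_add t (fun i => a i * _) hm, hall, mul_add, ← Finset.sum_erase_add t a hm]
    refine (bernU hp (ENNReal.sum_ne_top.2 fun i _ => ha i) (ha m)).trans ?_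
    gcongr
    refine ih'.trans ?_
    gcongr
    exact Finset.erase_subset _ _

open Classical in
lemma chainL (hr : ∀ i, r i i) (htr : ∀ i j k, r i j → r j k → r i k)
    {q : ℝ} (hq : 0 < q) (hq1 : q ≤ 1) (a : ι → ℝ≥0∞) (ha : ∀ i, a i ≠ ∞)
    (t : Finset ι) (tot : ∀ i ∈ t, ∀ j ∈ t, r i j ∨ r j i) :
    ENNReal.ofReal q * ∑ i ∈ t, a i * (∑ j ∈ t with r j i, a j) ^ (q - 1)
      ≤ (∑ i ∈ t, a i) ^ q := by
  induction t using Finset.strongInduction with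
  | H t ih =>
    rcases t.eq_empty_or_nonempty with rfl | hne
    · simp
    obtain ⟨m, hm, hmax⟩ := exists_max r hr htr t hne tot
    have ih' := ih (t.erase m) (Finset.erase_ssubset hm)
      fun i hi j hj => tot i (Finset.mem_of_mem_erase hi) j (Finset.mem_of_mem_erase hj)
    have hall : ∑ j ∈ t with r j m, a j = ∑ j ∈ t, a j := by
      rw [Finset.filter_true_of_mem hmax]
    rw [← Finset.sum_erase_add t (fun i => a i * _) hm, hall, mul_add, ← Finset.sum_erase_add t a hm, add_comm]
    refine le_trans ?_ (bernL hq hq1 (ENNReal.sum_ne_top.2 fun i _ => ha i) (ha m))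
    gcongr
    refine le_trans ?_ ih'
    gcongr ENNReal.ofReal q * ∑ i ∈ _, a i * ?_ with i hi
    refine rpow_anti (by linarith) ?_
    gcongr
    exact Finset.erase_subset _ _
end chain

section finite
open Classical

variable {X : Type*} [MeasurableSpace X] {ι : Type*}

def fS (A : ι → Set X) (a : ι → ℝ≥0∞) (s : Finset ι) (x : X) : ℝ≥0∞ :=
  ∑ i ∈ s, (A i).indicator (fun _ => a i) x

def fI (A : ι → Set X) (a : ι → ℝ≥0∞) (s : Finset ι) (i : ι) (x : X) : ℝ≥0∞ :=
  ∑ j ∈ s with A j ⊆ A i, (A j).indicator (fun _ => a j) x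

def oS (A : ι → Set X) (a : ι → ℝ≥0∞) (s : Finset ι) (i : ι) : ℝ≥0∞ :=
  ∑ k ∈ s with A i ⊆ A k, a k

def mS (μ : Measure X) (A : ι → Set X) (a : ι → ℝ≥0∞) (s : Finset ι) (i : ι) : ℝ≥0∞ :=
  ∑ j ∈ s with A j ⊆ A i, a j * μ (A j)

variable {A : ι → Set X} {a : ι → ℝ≥0∞}

lemma fS_eq (s : Finset ι) (x : X) : fS A a s x = ∑ i ∈ s with x ∈ A i, a i := by
  simp [fS, Finset.sum_filter, Set.indicator_apply]

lemma fI_eq (s : Finset ι) (i : ι) (x : X) :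
    fI A a s i x = ∑ j ∈ (s.filter (fun j => x ∈ A j)) with A j ⊆ A i, a j := by
  rw [Finset.filter_comm, Finset.sum_filter]
  simp [fI, Set.indicator_apply]

lemma fI_le (s : Finset ι) (i : ι) (x : X) : fI A a s i x ≤ fS A a s x := by
  unfold fI fS; gcongr; exact Finset.filter_subset _ _

lemma fI_zero (s : Finset ι) (i : ι) {x : X} (hx : x ∉ A i) : fI A a s i x = 0 := by
  unfold fI
  refine Finset.sum_eq_zero fun j hj => ?_
  rw [Set.indicator_of_notMem]
  exact fun h => hx ((Finset.mem_filter.1 hj).2 h)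

lemma oS_le (s : Finset ι) (i : ι) {x : X} (hx : x ∈ A i) : oS A a s i ≤ fS A a s x := by
  rw [fS_eq]; unfold oS
  refine Finset.sum_le_sum_of_subset ?_
  intro k hk
  rw [Finset.mem_filter] at hk ⊢
  exact ⟨hk.1, hk.2 hx⟩

lemma measurable_fS (hA : ∀ i, MeasurableSet (A i)) (s : Finset ι) :
    Measurable (fS A a s) :=
  Finset.measurable_fun_sum _ fun i _ => measurable_const.indicator (hA i)

lemma measurable_fI (hA : ∀ i, MeasurableSet (A i)) (s : Finset ι) (i : ι) :
    Measurable (fI A a s i) :=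
  Finset.measurable_fun_sum _ fun i _ => measurable_const.indicator (hA i)

lemma lintegral_fS (μ : Measure X) (hA : ∀ i, MeasurableSet (A i)) (s : Finset ι) :
    ∫⁻ x, fS A a s x ∂μ = ∑ i ∈ s, a i * μ (A i) := by
  unfold fS
  rw [lintegral_finsetSum _ fun i _ => measurable_const.indicator (hA i)]
  simp [lintegral_indicator_const, hA]

lemma lintegral_fI (μ : Measure X) (hA : ∀ i, MeasurableSet (A i)) (s : Finset ι) (i : ι) :
    ∫⁻ x, fI A a s i x ∂μ = mS μ A a s i :=
  lintegral_fS μ hA _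

lemma setLIntegral_fI (μ : Measure X) (hA : ∀ i, MeasurableSet (A i)) (s : Finset ι) (i : ι) :
    ∫⁻ x in A i, fI A a s i x ∂μ = mS μ A a s i := by
  rw [← lintegral_fI μ hA, ← lintegral_indicator (hA i)]
  congr 1; ext x
  by_cases hx : x ∈ A i
  · rw [Set.indicator_of_mem hx]
  · rw [Set.indicator_of_notMem hx, fI_zero _ _ hx]

lemma ptL2 {p : ℝ} (hp : 1 ≤ p) (s : Finset ι) (x : X) :
    ∑ i ∈ s, (A i).indicator (fun x => a i * fI A a s i x ^ (p - 1)) x ≤ fS A a s x ^ p := by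
  have : fS A a s x ^ p = fS A a s x * fS A a s x ^ (p - 1) := by
    conv_rhs => enter [1]; rw [← ENNReal.rpow_one (fS A a s x)]
    rw [← ENNReal.rpow_add_of_nonneg _ _ (by linarith) (by linarith)]
    congr 1; ring
  rw [this]
  conv_rhs => enter [1]; unfold fS
  rw [Finset.sum_mul]
  refine Finset.sum_le_sum fun i _ => ?_
  by_cases hx : x ∈ A i
  · simp only [Set.indicator_of_mem hx]
    gcongr
    exact fI_le _ _ _
  · simp [hx]

lemma ptO {q : ℝ} (hq : 0 ≤ q) (s : Finset ι) (x : X) :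
    ∑ i ∈ s, (A i).indicator (fun _ => a i * oS A a s i ^ q) x ≤ fS A a s x ^ (q + 1) := by
  have : fS A a s x ^ (q + 1) = fS A a s x * fS A a s x ^ q := by
    rw [ENNReal.rpow_add_of_nonneg _ _ (by linarith) (by linarith), ENNReal.rpow_one, mul_comm]
  rw [this]
  conv_rhs => enter [1]; unfold fS
  rw [Finset.sum_mul]
  refine Finset.sum_le_sum fun i _ => ?_
  by_cases hx : x ∈ A i
  · simp only [Set.indicator_of_mem hx]
    gcongr
    exact oS_le _ _ hx
  · simp [hx]

lemma total_filter (nest : ∀ i j, A i ⊆ A j ∨ A j ⊆ A i ∨ Disjoint (A i) (A j))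
    (x : X) (i j : ι) (hi : x ∈ A i) (hj : x ∈ A j) : A i ⊆ A j ∨ A j ⊆ A i := by
  rcases nest i j with h | h | h
  · exact Or.inl h
  · exact Or.inr h
  · exact (Set.disjoint_left.1 h hi hj).elim

lemma ptU1 (nest : ∀ i j, A i ⊆ A j ∨ A j ⊆ A i ∨ Disjoint (A i) (A j))
    (ha : ∀ i, a i ≠ ∞) {p : ℝ} (hp : 1 ≤ p) (s : Finset ι) (x : X) :
    fS A a s x ^ p ≤ ENNReal.ofReal p *
      ∑ i ∈ s, (A i).indicator (fun x => a i * fI A a s i x ^ (p - 1)) x := by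
  rw [fS_eq]
  refine (chainU (fun i j => A i ⊆ A j) (fun _ => subset_rfl) (fun _ _ _ => Set.Subset.trans) hp a ha
    _ ?_).trans ?_
  · intro i hi j hj
    rw [Finset.mem_filter] at hi hj
    exact total_filter nest x i j hi.2 hj.2
  · gcongr
    simp only [← fI_eq, Set.indicator_apply]
    rw [Finset.sum_filter]

lemma swap_sum (t : Finset ι) (g : ι → ℝ≥0∞) (b : ι → ℝ≥0∞) :
    ∑ j ∈ t, b j * ∑ i ∈ t with A j ⊆ A i, g i
      = ∑ i ∈ t, g i * ∑ j ∈ t with A j ⊆ A i, b j := by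
  simp only [Finset.sum_filter, Finset.mul_sum]
  rw [Finset.sum_comm]
  refine Finset.sum_congr rfl fun i _ => Finset.sum_congr rfl fun j _ => ?_
  split_ifs
  · ring
  · simp

lemma ptU2 (nest : ∀ i j, A i ⊆ A j ∨ A j ⊆ A i ∨ Disjoint (A i) (A j))
    (ha : ∀ i, a i ≠ ∞) {p : ℝ} (hp : 2 ≤ p) (s : Finset ι) (x : X) :
    fS A a s x ^ p ≤ ENNReal.ofReal p * (ENNReal.ofReal (p - 1) *
      ∑ i ∈ s, (a i * oS A a s i ^ (p - 1 - 1)) * fI A a s i x) := by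
  rw [fS_eq]
  set t := s.filter (fun i => x ∈ A i) with ht
  have tot : ∀ i ∈ t, ∀ j ∈ t, A j ⊆ A i ∨ A i ⊆ A j := by
    intro i hi j hj
    rw [Finset.mem_filter] at hi hj
    exact total_filter nest x j i hj.2 hi.2
  refine (chainU (fun i j => A j ⊆ A i) (fun _ => subset_rfl)
    (fun _ _ _ h1 h2 => Set.Subset.trans h2 h1) (by linarith) a ha t tot).trans ?_
  gcongr
  have h2 : ∀ j, (∑ k ∈ t with A j ⊆ A k, a k) ^ (p - 1) ≤ ENNReal.ofReal (p - 1) *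
      ∑ i ∈ t with A j ⊆ A i, a i * oS A a s i ^ (p - 1 - 1) := by
    intro j
    refine (chainU (fun i j => A j ⊆ A i) (fun _ => subset_rfl)
      (fun _ _ _ h1 h2 => Set.Subset.trans h2 h1) (by linarith) a ha _ ?_).trans ?_
    · intro i hi j hj
      exact tot i (Finset.filter_subset _ _ hi) j (Finset.filter_subset _ _ hj)
    · unfold oS
      gcongr
      · linarith
      · exact (Finset.filter_subset _ _).trans (Finset.filter_subset _ _)
  calc _ ≤ ∑ j ∈ t, a j * (ENNReal.ofReal (p - 1) *
      ∑ i ∈ t with A j ⊆ A i, a i * oS A a s i ^ (p - 1 - 1)) := by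
        gcongr with j hj
        exact h2 j
    _ = ENNReal.ofReal (p - 1) * ∑ j ∈ t, a j *
      ∑ i ∈ t with A j ⊆ A i, a i * oS A a s i ^ (p - 1 - 1) := by
        rw [Finset.mul_sum]; refine Finset.sum_congr rfl fun j _ => by ring
    _ ≤ _ := by
        rw [swap_sum]
        simp only [fI_eq, ← ht]
        gcongr
        exact Finset.filter_subset _ _

lemma ptL1 (nest : ∀ i j, A i ⊆ A j ∨ A j ⊆ A i ∨ Disjoint (A i) (A j))
    (ha : ∀ i, a i ≠ ∞) {q : ℝ} (hq : 0 < q) (hq1 : q ≤ 1) (s : Finset ι) (x : X) :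
    ENNReal.ofReal q * ∑ i ∈ s, (a i * oS A a s i ^ (q - 1)) * fI A a s i x
      ≤ fS A a s x ^ (q + 1) := by
  have e1 : ∑ i ∈ s, (a i * oS A a s i ^ (q - 1)) * fI A a s i x
      = ∑ i ∈ s with x ∈ A i, (a i * oS A a s i ^ (q - 1)) * fI A a s i x := by
    rw [Finset.sum_filter]
    refine Finset.sum_congr rfl fun i _ => ?_
    split_ifs with h
    · rfl
    · rw [fI_zero _ _ h, mul_zero]
  rw [e1, fS_eq]
  simp only [fI_eq]
  set t := s.filter (fun i => x ∈ A i) with ht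
  have tot : ∀ i ∈ t, ∀ j ∈ t, A j ⊆ A i ∨ A i ⊆ A j := by
    intro i hi j hj
    rw [Finset.mem_filter] at hi hj
    exact total_filter nest x j i hj.2 hi.2
  rw [← swap_sum, Finset.mul_sum, ENNReal.rpow_add_of_nonneg _ _ hq.le zero_le_one,
    ENNReal.rpow_one, Finset.mul_sum]
  refine Finset.sum_le_sum fun j hj => ?_
  have h2 : ENNReal.ofReal q * ∑ i ∈ t with A j ⊆ A i, a i * oS A a s i ^ (q - 1)
      ≤ (∑ k ∈ t with A j ⊆ A k, a k) ^ q := by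
    refine le_trans (le_of_eq ?_) (chainL (fun i j => A j ⊆ A i) (fun _ => subset_rfl)
      (fun _ _ _ h1 h2 => Set.Subset.trans h2 h1) hq hq1 a ha _ ?_)
    · congr 1
      refine Finset.sum_congr rfl fun i hi => ?_
      congr 2
      unfold oS
      refine Finset.sum_congr ?_ fun _ _ => rfl
      ext k
      simp only [ht, Finset.mem_filter] at hi ⊢
      constructor
      · rintro ⟨h1, h2⟩
        exact ⟨⟨⟨h1, h2 hi.1.2⟩, hi.2.trans h2⟩, h2⟩
      · rintro ⟨⟨⟨h1, _⟩, _⟩, h2⟩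
        exact ⟨h1, h2⟩
    · intro i hi j hj
      exact tot i (Finset.filter_subset _ _ hi) j (Finset.filter_subset _ _ hj)
  calc _ = a j * (ENNReal.ofReal q *
        ∑ i ∈ t with A j ⊆ A i, a i * oS A a s i ^ (q - 1)) := by ring
    _ ≤ a j * (∑ k ∈ t with A j ⊆ A k, a k) ^ q := by gcongr
    _ ≤ a j * (∑ k ∈ t, a k) ^ q := by
      gcongr
      exact Finset.filter_subset _ _
    _ = _ := mul_comm _ _

lemma absorb {x y : ℝ≥0∞} (hx : x ≠ ∞) (h : x ≤ 2⁻¹ * x + y) : x ≤ 2 * y := by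
  have h2 : x = 2⁻¹ * x + 2⁻¹ * x := by
    rw [← add_mul, ENNReal.inv_two_add_inv_two, one_mul]
  have h3 : 2⁻¹ * x ≤ y := by
    exact (ENNReal.add_le_add_iff_left (a := 2⁻¹ * x) (by finiteness)).1 (h2.symm.le.trans h)
  calc x = 2 * (2⁻¹ * x) := by
        rw [← mul_assoc, ENNReal.mul_inv_cancel (by norm_num) (by norm_num), one_mul]
    _ ≤ _ := by gcongr

lemma rpow_sub_one_mul {q : ℝ} (hq : 0 ≤ q) {w : ℝ≥0∞} (hw : w ≠ ∞) :
    w ^ (q - 1) * w ≤ w ^ q := by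
  rcases eq_or_ne w 0 with rfl | h0
  · simp
  · conv_lhs => enter [2]; rw [← ENNReal.rpow_one w]
    rw [← ENNReal.rpow_add _ _ h0 hw]
    simp

variable {μ : Measure X}

/-- average -/
def sg (μ : Measure X) (A : ι → Set X) (a : ι → ℝ≥0∞) (s : Finset ι) (i : ι) : ℝ≥0∞ :=
  (μ (A i))⁻¹ * mS μ A a s i

lemma mS_ne_top (hfin : ∀ i, μ (A i) ≠ ∞) (ha : ∀ i, a i ≠ ∞) (s : Finset ι) (i : ι) :
    mS μ A a s i ≠ ∞ :=
  ENNReal.sum_ne_top.2 fun j _ => ENNReal.mul_ne_top (ha j) (hfin j)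

lemma mS_zero (s : Finset ι) {i : ι} (h : μ (A i) = 0) : mS μ A a s i = 0 := by
  refine Finset.sum_eq_zero fun j hj => ?_
  rw [measure_mono_null (Finset.mem_filter.1 hj).2 h, mul_zero]

lemma sg_mul (hfin : ∀ i, μ (A i) ≠ ∞) (s : Finset ι) (i : ι) :
    sg μ A a s i * μ (A i) = mS μ A a s i := by
  rcases eq_or_ne (μ (A i)) 0 with h | h
  · rw [h, mS_zero s h, mul_zero]
  · rw [sg, mul_right_comm, ENNReal.inv_mul_cancel h (hfin i), one_mul]

lemma sg_ne_top (hfin : ∀ i, μ (A i) ≠ ∞) (ha : ∀ i, a i ≠ ∞) (s : Finset ι) {i : ι}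
    (h : μ (A i) ≠ 0) : sg μ A a s i ≠ ∞ :=
  ENNReal.mul_ne_top (by simpa using h) (mS_ne_top hfin ha s i)

def RS (μ : Measure X) (A : ι → Set X) (a : ι → ℝ≥0∞) (p : ℝ) (s : Finset ι) : ℝ≥0∞ :=
  ∑ i ∈ s, a i * sg μ A a s i ^ (p - 1) * μ (A i)

lemma lintegral_ind_sum (hA : ∀ i, MeasurableSet (A i)) (s : Finset ι) (g : ι → X → ℝ≥0∞)
    (hg : ∀ i, Measurable (g i)) :
    ∫⁻ x, ∑ i ∈ s, (A i).indicator (fun x => a i * g i x) x ∂μ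
      = ∑ i ∈ s, a i * ∫⁻ x in A i, g i x ∂μ := by
  rw [lintegral_finsetSum _ fun i _ => ((hg i).const_mul _).indicator (hA i)]
  refine Finset.sum_congr rfl fun i _ => ?_
  rw [lintegral_indicator (hA i), lintegral_const_mul _ (hg i)]

lemma lint_fS_ne_top (hA : ∀ i, MeasurableSet (A i)) (hfin : ∀ i, μ (A i) ≠ ∞)
    (ha : ∀ i, a i ≠ ∞) {p : ℝ} (hp : 1 ≤ p) (s : Finset ι) :
    ∫⁻ x, fS A a s x ^ p ∂μ ≠ ∞ := by
  have hle : ∀ x, fS A a s x ^ p ≤ fS A a s x * (∑ i ∈ s, a i) ^ (p - 1) := by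
    intro x
    have : fS A a s x ^ p = fS A a s x * fS A a s x ^ (p - 1) := by
      conv_rhs => enter [1]; rw [← ENNReal.rpow_one (fS A a s x)]
      rw [← ENNReal.rpow_add_of_nonneg _ _ (by linarith) (by linarith)]
      congr 1; ring
    rw [this]
    gcongr
    rw [fS_eq]
    gcongr
    exact Finset.filter_subset _ _
  refine ne_top_of_le_ne_top ?_ (lintegral_mono hle)
  rw [lintegral_mul_const _ (measurable_fS hA s), lintegral_fS μ hA]
  refine ENNReal.mul_ne_top (ENNReal.sum_ne_top.2 fun j _ => ENNReal.mul_ne_top (ha j) (hfin j))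
    (ENNReal.rpow_ne_top_of_nonneg (by linarith) (ENNReal.sum_ne_top.2 fun j _ => ha j))

lemma finU1 (hA : ∀ i, MeasurableSet (A i)) (hfin : ∀ i, μ (A i) ≠ ∞)
    (nest : ∀ i j, A i ⊆ A j ∨ A j ⊆ A i ∨ Disjoint (A i) (A j))
    (ha : ∀ i, a i ≠ ∞) {p : ℝ} (hp : 1 ≤ p) (hp2 : p ≤ 2) (s : Finset ι) :
    ∫⁻ x, fS A a s x ^ p ∂μ ≤ ENNReal.ofReal p * 2 * RS μ A a p s := by
  refine (lintegral_mono (ptU1 nest ha hp s)).trans ?_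
  have hm : ∀ i, Measurable (fun x => fI A a s i x ^ (p - 1)) :=
    fun i => (measurable_fI hA s i).pow_const _
  rw [lintegral_const_mul _ (Finset.measurable_fun_sum _ fun i _ =>
    ((hm i).const_mul _).indicator (hA i)), lintegral_ind_sum hA s _ hm, mul_assoc]
  gcongr
  rw [RS, Finset.mul_sum]
  refine Finset.sum_le_sum fun i _ => ?_
  rcases eq_or_ne (μ (A i)) 0 with h0 | h0
  · rw [setLIntegral_measure_zero _ _ h0]; simp
  have key : ∫⁻ x in A i, fI A a s i x ^ (p - 1) ∂μ
      ≤ 2 * (sg μ A a s i ^ (p - 1) * μ (A i)) := by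
    refine (lintegral_mono fun x => splitZ (q := p - 1) (by linarith) (by linarith)
      (fI A a s i x) (sg μ A a s i)).trans ?_
    rw [lintegral_add_left measurable_const, setLIntegral_const,
      lintegral_const_mul _ (measurable_fI hA s i), setLIntegral_fI μ hA, ← sg_mul hfin,
      ← mul_assoc, two_mul]
    gcongr
    exact rpow_sub_one_mul (by linarith) (sg_ne_top hfin ha s h0)
  calc _ ≤ a i * (2 * (sg μ A a s i ^ (p - 1) * μ (A i))) := by gcongr
    _ = _ := by ring

lemma finL2 (hA : ∀ i, MeasurableSet (A i)) (hfin : ∀ i, μ (A i) ≠ ∞)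
    (ha : ∀ i, a i ≠ ∞) {p : ℝ} (hp : 2 ≤ p) (s : Finset ι) :
    RS μ A a p s ≤ 2 * 2 ^ (p - 1 - 1) * ∫⁻ x, fS A a s x ^ p ∂μ := by
  have hm : ∀ i, Measurable (fun x => fI A a s i x ^ (p - 1)) :=
    fun i => (measurable_fI hA s i).pow_const _
  have h1 := lintegral_mono (μ := μ) (ptL2 (A := A) (a := a) (p := p) (by linarith) s)
  rw [lintegral_ind_sum hA s _ hm] at h1
  refine le_trans ?_ (mul_le_mul_right h1 _)
  rw [RS, Finset.mul_sum]
  refine Finset.sum_le_sum fun i _ => ?_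
  rcases eq_or_ne (μ (A i)) 0 with h0 | h0
  · rw [h0]; simp
  have hσ := sg_ne_top hfin ha s h0
  have key : sg μ A a s i ^ (p - 1) * μ (A i)
      ≤ 2 * (2 ^ (p - 1 - 1) * ∫⁻ x in A i, fI A a s i x ^ (p - 1) ∂μ) := by
    refine absorb (ENNReal.mul_ne_top (ENNReal.rpow_ne_top_of_nonneg (by linarith) hσ)
      (hfin i)) ?_
    calc sg μ A a s i ^ (p - 1) * μ (A i)
        = sg μ A a s i ^ (p - 1 - 1) * mS μ A a s i := by
          rw [← sg_mul hfin, ← mul_assoc]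
          conv_rhs => enter [1, 2]; rw [← ENNReal.rpow_one (sg μ A a s i)]
          rw [← ENNReal.rpow_add_of_nonneg _ _ (by linarith) (by linarith)]
          congr 2; ring
      _ = ∫⁻ x in A i, sg μ A a s i ^ (p - 1 - 1) * fI A a s i x ∂μ := by
          rw [lintegral_const_mul _ (measurable_fI hA s i), setLIntegral_fI μ hA]
      _ ≤ ∫⁻ x in A i, (2⁻¹ * sg μ A a s i ^ (p - 1)
            + (2⁻¹⁻¹) ^ (p - 1 - 1) * fI A a s i x ^ (p - 1)) ∂μ :=
          lintegral_mono fun x => splitY (by linarith) (by norm_num) (by norm_num) _ _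
      _ = _ := by
          rw [lintegral_add_left measurable_const, setLIntegral_const,
            lintegral_const_mul _ (hm i), inv_inv, mul_assoc]
  calc _ = a i * (sg μ A a s i ^ (p - 1) * μ (A i)) := by ring
    _ ≤ _ := mul_le_mul_right key _
    _ = _ := by ring

lemma finO (hA : ∀ i, MeasurableSet (A i)) {q : ℝ} (hq : 0 ≤ q) (s : Finset ι) :
    ∑ i ∈ s, a i * oS A a s i ^ q * μ (A i) ≤ ∫⁻ x, fS A a s x ^ (q + 1) ∂μ := by
  have h1 := lintegral_mono (μ := μ) (ptO (A := A) (a := a) hq s)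
  rw [lintegral_ind_sum hA s _ (fun i => measurable_const)] at h1
  simpa [mul_assoc] using h1

lemma lint_o (hA : ∀ i, MeasurableSet (A i)) (s : Finset ι) (b : ι → ℝ≥0∞) :
    ∫⁻ x, ∑ i ∈ s, b i * fI A a s i x ∂μ = ∑ i ∈ s, b i * mS μ A a s i := by
  rw [lintegral_finsetSum _ fun i _ => (measurable_fI hA s i).const_mul _]
  refine Finset.sum_congr rfl fun i _ => ?_
  rw [lintegral_const_mul _ (measurable_fI hA s i), lintegral_fI μ hA]

lemma finL1 (hA : ∀ i, MeasurableSet (A i)) (hfin : ∀ i, μ (A i) ≠ ∞)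
    (nest : ∀ i j, A i ⊆ A j ∨ A j ⊆ A i ∨ Disjoint (A i) (A j))
    (ha : ∀ i, a i ≠ ∞) {p : ℝ} (hp : 1 < p) (hp2 : p ≤ 2) (s : Finset ι) :
    RS μ A a p s ≤ (1 + (ENNReal.ofReal (p - 1))⁻¹) * ∫⁻ x, fS A a s x ^ p ∂μ := by
  have hq0 : ENNReal.ofReal (p - 1) ≠ 0 := by
    rw [Ne, ENNReal.ofReal_eq_zero]; linarith
  have h1 := finO (μ := μ) (a := a) hA (q := p - 1) (by linarith) s
  have h2 := lintegral_mono (μ := μ) (ptL1 (q := p - 1) nest ha (by linarith) (by linarith) s)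
  rw [lintegral_const_mul _ (Finset.measurable_fun_sum _ fun i _ =>
    (measurable_fI hA s i).const_mul _), lint_o hA] at h2
  rw [sub_add_cancel] at h1 h2
  rw [add_mul, one_mul]
  calc RS μ A a p s ≤ ∑ i ∈ s, (a i * oS A a s i ^ (p - 1) * μ (A i)
        + a i * oS A a s i ^ (p - 1 - 1) * mS μ A a s i) := by
        refine Finset.sum_le_sum fun i _ => ?_
        rw [← sg_mul hfin]
        calc _ ≤ a i * (oS A a s i ^ (p - 1) + oS A a s i ^ (p - 1 - 1) * sg μ A a s i)
                * μ (A i) := by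
              gcongr
              exact splitZ (by linarith) (by linarith) _ _
          _ = _ := by ring
    _ ≤ _ := by
        rw [Finset.sum_add_distrib]
        refine add_le_add h1 ?_
        calc _ = (ENNReal.ofReal (p - 1))⁻¹ * (ENNReal.ofReal (p - 1) *
              ∑ i ∈ s, a i * oS A a s i ^ (p - 1 - 1) * mS μ A a s i) := by
              rw [← mul_assoc, ENNReal.inv_mul_cancel hq0 (by finiteness), one_mul]
          _ ≤ _ := mul_le_mul_right h2 _

lemma finU2 (hA : ∀ i, MeasurableSet (A i)) (hfin : ∀ i, μ (A i) ≠ ∞)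
    (nest : ∀ i j, A i ⊆ A j ∨ A j ⊆ A i ∨ Disjoint (A i) (A j))
    (ha : ∀ i, a i ≠ ∞) {p : ℝ} (hp : 2 ≤ p) (s : Finset ι) {P : ℝ≥0∞}
    (hP : P = ENNReal.ofReal p * ENNReal.ofReal (p - 1)) :
    ∫⁻ x, fS A a s x ^ p ∂μ ≤ 2 * (P * (2 * P) ^ (p - 1 - 1)) * RS μ A a p s := by
  have hP0 : P ≠ 0 := by
    rw [hP]; refine mul_ne_zero ?_ ?_ <;> rw [Ne, ENNReal.ofReal_eq_zero] <;> linarith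
  have hP1 : P ≠ ∞ := by rw [hP]; finiteness
  have h1 := finO (μ := μ) (a := a) hA (q := p - 1) (by linarith) s
  rw [sub_add_cancel] at h1
  have h2 := lintegral_mono (μ := μ) (ptU2 nest ha hp s)
  have hmm : Measurable fun x => ∑ i ∈ s, (a i * oS A a s i ^ (p - 1 - 1)) * fI A a s i x :=
    Finset.measurable_fun_sum _ fun i _ => (measurable_fI hA s i).const_mul _
  rw [lintegral_const_mul _ (hmm.const_mul _), lintegral_const_mul _ hmm, lint_o hA,
    ← mul_assoc, ← hP] at h2
  rw [mul_assoc]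
  refine absorb (lint_fS_ne_top hA hfin ha (by linarith) s) (h2.trans ?_)
  have e0 : (2 * P)⁻¹ ≠ 0 := by simp; finiteness
  have e1 : (2 * P)⁻¹ ≠ ∞ := by simp [hP0]
  have e2 : P * (2 * P)⁻¹ = 2⁻¹ := by
    rw [ENNReal.mul_inv (by simp) (by simp), mul_left_comm, ENNReal.mul_inv_cancel hP0 hP1,
      mul_one]
  calc _ ≤ P * ∑ i ∈ s, ((2 * P)⁻¹ * (a i * oS A a s i ^ (p - 1) * μ (A i))
        + (2 * P) ^ (p - 1 - 1) * (a i * sg μ A a s i ^ (p - 1) * μ (A i))) := by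
        gcongr with i hi
        rw [← sg_mul hfin]
        have := splitY (q := p - 1) (by linarith) e0 e1 (oS A a s i) (sg μ A a s i)
        rw [inv_inv] at this
        calc _ = a i * (oS A a s i ^ (p - 1 - 1) * sg μ A a s i) * μ (A i) := by ring
          _ ≤ _ := mul_le_mul_left (mul_le_mul_right this _) _
          _ = _ := by ring
    _ = 2⁻¹ * (∑ i ∈ s, a i * oS A a s i ^ (p - 1) * μ (A i))
        + P * (2 * P) ^ (p - 1 - 1) * RS μ A a p s := by
        rw [Finset.sum_add_distrib, ← Finset.mul_sum, ← Finset.mul_sum, mul_add, ← mul_assoc, e2,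
          RS, mul_assoc P]
    _ ≤ _ := by gcongr

/-- Finite version. -/
lemma fin_main {p : ℝ} (hp : 1 ≤ p) : ∃ K : ℝ≥0∞, K ≠ ∞ ∧
    ∀ {X : Type} [MeasurableSpace X] {ι : Type} (μ : Measure X) (A : ι → Set X)
      (a : ι → ℝ≥0∞), (∀ i, MeasurableSet (A i)) → (∀ i, μ (A i) ≠ ∞) →
      (∀ i j, A i ⊆ A j ∨ A j ⊆ A i ∨ Disjoint (A i) (A j)) → (∀ i, a i ≠ ∞) →
      ∀ s : Finset ι, ∫⁻ x, fS A a s x ^ p ∂μ ≤ K * RS μ A a p s ∧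
        RS μ A a p s ≤ K * ∫⁻ x, fS A a s x ^ p ∂μ := by
  obtain ⟨K1, hK1, H1⟩ : ∃ K : ℝ≥0∞, K ≠ ∞ ∧
    ∀ {X : Type} [MeasurableSpace X] {ι : Type} (μ : Measure X) (A : ι → Set X)
      (a : ι → ℝ≥0∞), (∀ i, MeasurableSet (A i)) → (∀ i, μ (A i) ≠ ∞) →
      (∀ i j, A i ⊆ A j ∨ A j ⊆ A i ∨ Disjoint (A i) (A j)) → (∀ i, a i ≠ ∞) →
      ∀ s : Finset ι, ∫⁻ x, fS A a s x ^ p ∂μ ≤ K * RS μ A a p s := by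
    rcases le_total p 2 with h | h
    · exact ⟨ENNReal.ofReal p * 2, by finiteness, fun μ A a hA hfin nest ha s =>
        finU1 hA hfin nest ha hp h s⟩
    · refine ⟨2 * (ENNReal.ofReal p * ENNReal.ofReal (p - 1) *
        (2 * (ENNReal.ofReal p * ENNReal.ofReal (p - 1))) ^ (p - 1 - 1)), ?_,
        fun μ A a hA hfin nest ha s => finU2 hA hfin nest ha h s rfl⟩
      have : (2 * (ENNReal.ofReal p * ENNReal.ofReal (p - 1))) ^ (p - 1 - 1) ≠ ∞ :=
        ENNReal.rpow_ne_top_of_nonneg (by linarith) (by finiteness)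
      finiteness
  obtain ⟨K2, hK2, H2⟩ : ∃ K : ℝ≥0∞, K ≠ ∞ ∧
    ∀ {X : Type} [MeasurableSpace X] {ι : Type} (μ : Measure X) (A : ι → Set X)
      (a : ι → ℝ≥0∞), (∀ i, MeasurableSet (A i)) → (∀ i, μ (A i) ≠ ∞) →
      (∀ i j, A i ⊆ A j ∨ A j ⊆ A i ∨ Disjoint (A i) (A j)) → (∀ i, a i ≠ ∞) →
      ∀ s : Finset ι, RS μ A a p s ≤ K * ∫⁻ x, fS A a s x ^ p ∂μ := by
    rcases le_total p 2 with h | h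
    · rcases hp.eq_or_lt with h1 | h1
      · refine ⟨1, by simp, fun μ A a hA hfin nest ha s => ?_⟩
        rw [← h1]
        simp [RS, lintegral_fS μ hA]
      · refine ⟨1 + (ENNReal.ofReal (p - 1))⁻¹, ?_, fun μ A a hA hfin nest ha s =>
          finL1 hA hfin nest ha h1 h s⟩
        have : ENNReal.ofReal (p - 1) ≠ 0 := by
          rw [Ne, ENNReal.ofReal_eq_zero]; linarith
        finiteness
    · refine ⟨2 * 2 ^ (p - 1 - 1), ?_, fun μ A a hA hfin nest ha s => finL2 hA hfin ha h s⟩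
      have : (2 : ℝ≥0∞) ^ (p - 1 - 1) ≠ ∞ :=
        ENNReal.rpow_ne_top_of_nonneg (by linarith) (by finiteness)
      finiteness
  refine ⟨K1 + K2, by finiteness, fun μ A a hA hfin nest ha s => ⟨?_, ?_⟩⟩
  · refine (H1 μ A a hA hfin nest ha s).trans ?_
    gcongr; exact le_self_add
  · refine (H2 μ A a hA hfin nest ha s).trans ?_
    gcongr; exact le_add_self

def RT (μ : Measure X) (A : ι → Set X) (a : ι → ℝ≥0∞) (p : ℝ) : ℝ≥0∞ :=
  ∑' i, a i * ((μ (A i))⁻¹ * ∑' j, if A j ⊆ A i then a j * μ (A j) else 0) ^ (p - 1) * μ (A i)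

lemma mS_eq (s : Finset ι) (i : ι) :
    mS μ A a s i = ∑ j ∈ s, if A j ⊆ A i then a j * μ (A j) else 0 := by
  rw [mS, Finset.sum_filter]

lemma RS_le_RT {p : ℝ} (hp : 1 ≤ p) (s : Finset ι) : RS μ A a p s ≤ RT μ A a p := by
  refine le_trans ?_ (ENNReal.sum_le_tsum s)
  unfold RS sg
  gcongr with i hi
  rw [mS_eq]
  exact ENNReal.sum_le_tsum s

lemma RT_le {p : ℝ} (hp : 1 ≤ p) (ha : ∀ i, a i ≠ ∞) (hfin : ∀ i, μ (A i) ≠ ∞) {B : ℝ≥0∞}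
    (h : ∀ s, RS μ A a p s ≤ B) : RT μ A a p ≤ B := by
  unfold RT
  rw [ENNReal.tsum_eq_iSup_sum]
  refine iSup_le fun s => ?_
  have ht : Filter.Tendsto (fun t : Finset ι => ∑ i ∈ s, a i * sg μ A a t i ^ (p - 1) * μ (A i))
      Filter.atTop (nhds (∑ i ∈ s, a i * ((μ (A i))⁻¹ *
        ∑' j, if A j ⊆ A i then a j * μ (A j) else 0) ^ (p - 1) * μ (A i))) := by
    refine tendsto_finsetSum _ fun i _ => ?_
    rcases eq_or_ne (μ (A i)) 0 with h0 | h0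
    · simp [h0]
    refine ENNReal.Tendsto.mul_const ?_ (Or.inr (hfin i))
    refine ENNReal.Tendsto.const_mul ?_ (Or.inr (ha i))
    refine (ENNReal.continuous_rpow_const.tendsto _).comp ?_
    unfold sg
    refine ENNReal.Tendsto.const_mul ?_ (Or.inr (by simpa using h0))
    simp only [mS_eq]
    exact ENNReal.summable.hasSum
  refine le_of_tendsto ht ?_
  filter_upwards [Filter.eventually_ge_atTop s] with t hst
  exact le_trans (Finset.sum_le_sum_of_subset hst) (h t)

lemma lint_tsum [Countable ι] (hA : ∀ i, MeasurableSet (A i)) {p : ℝ} (hp : 1 ≤ p) :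
    ∫⁻ x, (∑' i, (A i).indicator (fun _ => a i) x) ^ p ∂μ
      = ⨆ s : Finset ι, ∫⁻ x, fS A a s x ^ p ∂μ := by
  rw [← lintegral_iSup_directed]
  · refine lintegral_congr fun x => ?_
    rw [ENNReal.tsum_eq_iSup_sum]
    exact (ENNReal.orderIsoRpow p (by linarith)).map_iSup _
  · exact fun s => ((measurable_fS hA s).pow_const _).aemeasurable
  · refine Monotone.directed_le fun s t hst x => ?_
    refine ENNReal.rpow_le_rpow ?_ (by linarith)
    exact Finset.sum_le_sum_of_subset hst

lemma inf_main {p : ℝ} (hp : 1 ≤ p) : ∃ K : ℝ≥0∞, K ≠ ∞ ∧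
    ∀ {X : Type} [MeasurableSpace X] {ι : Type} [Countable ι] (μ : Measure X) (A : ι → Set X)
      (a : ι → ℝ≥0∞), (∀ i, MeasurableSet (A i)) → (∀ i, μ (A i) ≠ ∞) →
      (∀ i j, A i ⊆ A j ∨ A j ⊆ A i ∨ Disjoint (A i) (A j)) → (∀ i, a i ≠ ∞) →
      ∫⁻ x, (∑' i, (A i).indicator (fun _ => a i) x) ^ p ∂μ ≤ K * RT μ A a p ∧
      RT μ A a p ≤ K * ∫⁻ x, (∑' i, (A i).indicator (fun _ => a i) x) ^ p ∂μ := by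
  obtain ⟨K, hK, H⟩ := fin_main hp
  refine ⟨K, hK, fun μ A a hA hfin nest ha => ?_⟩
  have H' := H μ A a hA hfin nest ha
  rw [lint_tsum hA hp]
  constructor
  · exact iSup_le fun s => (H' s).1.trans (mul_le_mul_right (RS_le_RT hp s) _)
  · refine RT_le hp ha hfin fun s => (H' s).2.trans (mul_le_mul_right ?_ _)
    exact le_iSup (fun s : Finset _ => ∫⁻ x, fS A a s x ^ p ∂μ) s

end finite

section geometry
variable {n : ℕ}

lemma child_subset (Q : Cube n) (ε : Fin n → Bool) : (Q.child ε).set ⊆ Q.set := by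
  intro y hy i
  have h := hy i
  have hp := Q.h_pos
  simp only [Cube.child] at h
  split_ifs at h <;> constructor <;> linarith [h.1, h.2]

lemma child_disjoint (Q : Cube n) {ε ε' : Fin n → Bool} (h : ε ≠ ε') :
    Disjoint (Q.child ε).set (Q.child ε').set := by
  obtain ⟨i, hi⟩ := Function.ne_iff.1 h
  rw [Set.disjoint_left]
  intro y hy hy'
  have h1 := hy i
  have h2 := hy' i
  have hp := Q.h_pos
  simp only [Cube.child] at h1 h2
  cases he : ε i <;> cases he' : ε' i <;> simp [he, he'] at h1 h2 hi <;> linarith [h1.1, h1.2, h2.1, h2.2]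

lemma descendant_subset {R Q : Cube n} (h : descendant R Q) : Q.set ⊆ R.set := by
  induction h with
  | refl => exact subset_rfl
  | tail _ h ih =>
    obtain ⟨ε, rfl⟩ := h
    exact (child_subset _ ε).trans ih

lemma descendant_nested {R Q Q' : Cube n} (h : descendant R Q) :
    descendant R Q' → (Q.set ⊆ Q'.set ∨ Q'.set ⊆ Q.set ∨ Disjoint Q.set Q'.set) := by
  induction h using Relation.ReflTransGen.head_induction_on with
  | refl => exact fun h' => Or.inr (Or.inl (descendant_subset h'))
  | @head R S hRS hSQ ih =>
    intro h'
    rcases Relation.ReflTransGen.cases_head h' with rfl | ⟨S', hS', hS'Q'⟩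
    · obtain ⟨ε, rfl⟩ := hRS
      exact Or.inl ((descendant_subset hSQ).trans (child_subset _ ε))
    · obtain ⟨ε, rfl⟩ := hRS
      obtain ⟨ε', rfl⟩ := hS'
      by_cases he : ε = ε'
      · subst he; exact ih hS'Q'
      · exact Or.inr (Or.inr ((child_disjoint R he).mono (descendant_subset hSQ)
          (descendant_subset hS'Q')))

def ratRel (P Q : Cube n) : Prop :=
  ∃ w : ℚ × (Fin n → ℚ), Q.h = P.h * w.1 ∧ ∀ i, Q.c i = P.c i + P.h * w.2 i

lemma ratRel_trans {P Q R : Cube n} (h1 : ratRel P Q) (h2 : ratRel Q R) : ratRel P R := by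
  obtain ⟨⟨r, v⟩, hr, hv⟩ := h1
  obtain ⟨⟨r', v'⟩, hr', hv'⟩ := h2
  refine ⟨⟨r * r', fun i => v i + r * v' i⟩, ?_, fun i => ?_⟩
  · simp only at *; rw [hr', hr]; push_cast; ring
  · simp only at *; rw [hv', hv, hr]; push_cast; ring

lemma ratRel_symm {P Q : Cube n} (h1 : ratRel P Q) : ratRel Q P := by
  obtain ⟨⟨r, v⟩, hr, hv⟩ := h1
  simp only at hr hv
  have hr0 : (r : ℝ) ≠ 0 := by
    intro h; have := Q.h_pos; rw [hr, h] at this; simp at this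
  refine ⟨⟨r⁻¹, fun i => - (v i * r⁻¹)⟩, ?_, fun i => ?_⟩
  · simp only; rw [hr]; push_cast; field_simp
  · simp only; rw [hv, hr]; push_cast; field_simp; ring

lemma ratRel_desc {P Q : Cube n} (h : descendant P Q) : ratRel P Q := by
  induction h with
  | refl => exact ⟨⟨1, 0⟩, by simp, by simp⟩
  | tail _ h ih =>
    obtain ⟨ε, rfl⟩ := h
    refine ratRel_trans ih ⟨⟨1 / 2, fun i => if ε i then 1 / 2 else - (1 / 2)⟩, ?_, fun i => ?_⟩
    · simp [Cube.child]; ring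
    · simp only [Cube.child]; split_ifs <;> push_cast <;> ring

lemma lattice_countable {D : Set (Cube n)} (hD : IsDyadicLattice D) : Countable D := by
  rcases D.eq_empty_or_nonempty with rfl | ⟨P, hP⟩
  · infer_instance
  have h : ∀ Q : D, ratRel P Q.1 := by
    intro Q
    obtain ⟨R, _, h1, h2⟩ := hD.common_ancestor P hP Q.1 Q.2
    exact ratRel_trans (ratRel_symm (ratRel_desc h1)) (ratRel_desc h2)
  choose w hw hv using h
  refine Function.Injective.countable (f := w) fun Q Q' he => ?_
  apply Subtype.ext
  have e1 : Q.1.h = Q'.1.h := by rw [hw, hw, he]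
  have e2 : Q.1.c = Q'.1.c := by ext i; rw [hv, hv, he]
  rcases Q with ⟨⟨c, h, _⟩, _⟩
  rcases Q' with ⟨⟨c', h', _⟩, _⟩
  simp only at e1 e2
  subst e1; subst e2; rfl

lemma measurableSet_cube (Q : Cube n) : MeasurableSet Q.set := by
  have : Q.set = Set.pi Set.univ fun i => Set.Ico (Q.c i - Q.h) (Q.c i + Q.h) := by
    ext y; simp [Cube.set, Set.mem_pi]
  rw [this]
  exact MeasurableSet.univ_pi fun i => measurableSet_Ico

lemma wInt_ne_top {ω : (Fin n → ℝ) → ℝ} (hω : LocallyIntegrable ω volume) (Q : Cube n) :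
    wInt ω Q ≠ ∞ := by
  have hsub : Q.set ⊆ Set.Icc (fun i => Q.c i - Q.h) (fun i => Q.c i + Q.h) :=
    fun y hy => ⟨fun i => (hy i).1, fun i => (hy i).2.le⟩
  have hi := (hω.integrableOn_isCompact (isCompact_Icc
    (a := fun i => Q.c i - Q.h) (b := fun i => Q.c i + Q.h))).mono_set hsub
  refine ne_top_of_le_ne_top hi.2.ne ?_
  unfold wInt
  refine lintegral_mono fun x => ?_
  rw [← ofReal_norm]
  exact ENNReal.ofReal_le_ofReal (le_abs_self _)

end geometry

/-- **A norm formula for dyadic sums** (Cascante–Ortega–Verbitsky): for `p ∈ [1,∞)`,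
`‖Σ_Q λ_Q χ_Q‖_{L^p(ω)} ≃ (Σ_Q λ_Q (ω(Q)⁻¹ Σ_{Q'⊆Q} λ_{Q'} ω(Q'))^{p-1} ω(Q))^{1/p}`,
with constants depending only on `p`. -/
theorem dyadic_sum_norm (p : ℝ) (hp : 1 ≤ p) :
    ∃ c C : ℝ≥0∞, 0 < c ∧ C < ∞ ∧
      ∀ (n : ℕ) (D : Set (Cube n)), IsDyadicLattice D →
      ∀ lam : Cube n → ℝ, (∀ Q, 0 ≤ lam Q) →
      ∀ ω : (Fin n → ℝ) → ℝ, (∀ x, 0 ≤ ω x) → LocallyIntegrable ω volume →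
        c * (∑' Q : D, ENNReal.ofReal (lam Q.1) *
              ((wInt ω Q.1)⁻¹ * ∑' Q' : {Q' : Cube n // Q' ∈ D ∧ Q'.set ⊆ Q.1.set},
                  ENNReal.ofReal (lam Q'.1) * wInt ω Q'.1) ^ (p - 1) *
              wInt ω Q.1) ^ (1 / p) ≤
          (∫⁻ x, (∑' Q : D, Q.1.set.indicator (fun _ => ENNReal.ofReal (lam Q.1)) x) ^ p *
              ENNReal.ofReal (ω x)) ^ (1 / p) ∧
        (∫⁻ x, (∑' Q : D, Q.1.set.indicator (fun _ => ENNReal.ofReal (lam Q.1)) x) ^ p *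
            ENNReal.ofReal (ω x)) ^ (1 / p) ≤
          C * (∑' Q : D, ENNReal.ofReal (lam Q.1) *
              ((wInt ω Q.1)⁻¹ * ∑' Q' : {Q' : Cube n // Q' ∈ D ∧ Q'.set ⊆ Q.1.set},
                  ENNReal.ofReal (lam Q'.1) * wInt ω Q'.1) ^ (p - 1) *
              wInt ω Q.1) ^ (1 / p) := by
  classical
  obtain ⟨K, hK, H⟩ := inf_main hp
  have hp0 : 0 ≤ 1 / p := by positivity
  have hKp : K ^ (1 / p) ≠ ∞ := ENNReal.rpow_ne_top_of_nonneg hp0 hK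
  refine ⟨(K ^ (1 / p))⁻¹, K ^ (1 / p), by simpa using hKp, hKp.lt_top, ?_⟩
  intro n D hD lam hlam ω hω hloc
  have := lattice_countable hD
  set μ : Measure (Fin n → ℝ) := volume.withDensity fun x => ENNReal.ofReal (ω x) with hμ
  have hwm : AEMeasurable (fun x => ENNReal.ofReal (ω x)) volume :=
    hloc.aestronglyMeasurable.aemeasurable.ennreal_ofReal
  have hQ : ∀ Q : Cube n, μ Q.set = wInt ω Q := fun Q =>
    withDensity_apply _ (measurableSet_cube Q)
  obtain ⟨h1, h2⟩ := H μ (fun Q : D => Q.1.set) (fun Q : D => ENNReal.ofReal (lam Q.1))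
    (fun Q => measurableSet_cube _) (fun Q => by rw [hQ]; exact wInt_ne_top hloc _)
    (fun Q Q' => by
      obtain ⟨R, _, h1, h2⟩ := hD.common_ancestor Q.1 Q.2 Q'.1 Q'.2
      exact descendant_nested h1 h2)
    (fun Q => ENNReal.ofReal_ne_top)
  have hm : Measurable fun x =>
      (∑' Q : D, Q.1.set.indicator (fun _ => ENNReal.ofReal (lam Q.1)) x) ^ p :=
    (Measurable.ennreal_tsum (f := fun (Q : D) (x : Fin n → ℝ) =>
      Q.1.set.indicator (fun _ => ENNReal.ofReal (lam Q.1)) x) fun Q =>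
      measurable_const.indicator (measurableSet_cube Q.1)).pow_const _
  have hI : ∫⁻ x, (∑' Q : D, Q.1.set.indicator (fun _ => ENNReal.ofReal (lam Q.1)) x) ^ p ∂μ
      = ∫⁻ x, (∑' Q : D, Q.1.set.indicator (fun _ => ENNReal.ofReal (lam Q.1)) x) ^ p *
            ENNReal.ofReal (ω x) := by
    rw [hμ, lintegral_withDensity_eq_lintegral_mul₀ hwm hm.aemeasurable]
    refine lintegral_congr fun x => ?_
    rw [Pi.mul_apply, mul_comm]
  have hin : ∀ Q : D, (∑' Q' : {Q' : Cube n // Q' ∈ D ∧ Q'.set ⊆ Q.1.set},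
                  ENNReal.ofReal (lam Q'.1) * wInt ω Q'.1)
      = ∑' Q' : D, if Q'.1.set ⊆ Q.1.set then ENNReal.ofReal (lam Q'.1) * wInt ω Q'.1 else 0 := by
    intro Q
    have e := tsum_subtype {Q' : D | Q'.1.set ⊆ Q.1.set}
      (fun Q' : D => ENNReal.ofReal (lam Q'.1) * wInt ω Q'.1)
    simp only [Set.indicator_apply, Set.mem_ofPred_eq] at e
    rw [← e]
    exact ((Equiv.subtypeSubtypeEquivSubtypeInter (fun Q' => Q' ∈ D)
      (fun Q' : Cube n => Q'.set ⊆ Q.1.set)).tsum_eq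
      (fun Q' => ENNReal.ofReal (lam Q'.1) * wInt ω Q'.1)).symm
  have hR : RT μ (fun Q : D => Q.1.set) (fun Q : D => ENNReal.ofReal (lam Q.1)) p
      = ∑' Q : D, ENNReal.ofReal (lam Q.1) *
              ((wInt ω Q.1)⁻¹ * ∑' Q' : {Q' : Cube n // Q' ∈ D ∧ Q'.set ⊆ Q.1.set},
                  ENNReal.ofReal (lam Q'.1) * wInt ω Q'.1) ^ (p - 1) *
              wInt ω Q.1 := by
    unfold RT
    simp only [hin, hQ]
  rw [hI, hR] at h1 h2
  have h1' := ENNReal.rpow_le_rpow h1 hp0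
  have h2' := ENNReal.rpow_le_rpow h2 hp0
  rw [ENNReal.mul_rpow_of_nonneg _ _ hp0] at h1' h2'
  refine ⟨?_, h1'⟩
  refine (mul_le_mul_right h2' _).trans ?_
  rw [← mul_assoc]
  exact (mul_le_mul_left (ENNReal.inv_mul_le_one _) _).trans (one_mul _).le

end Frac
end
end

section
/- Let n ≥ 1 and 0 < α < n. Define the grand maximal truncation operator 𝓜_{I_α,∞} f(x) := sup_{Q ∋ x} esssup_{y ∈ Q} |I_α(f χ_{ℝⁿ∖3Q})(y)|, where the supremum is over all cubes Q containing x and 3Q is the concentric 3-dilate of Q. Then there is a constant C = C(n, α) such that for every f ∈ L¹(ℝⁿ) and every λ > 0: |{x ∈ ℝⁿ : 𝓜_{I_α,∞} f(x) > λ}| ≤ C ( ‖f‖_{L¹} / λ )^{n/(n−α)}; that is, 𝓜_{I_α,∞} is bounded from L¹(ℝⁿ) to the weak space L^{n/(n−α),∞}(ℝⁿ). -/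
open MeasureTheory Set ENNReal

noncomputable section

namespace Frac

/-- The fractional integral `I_α f(x) = ∫ f(y) |x-y|^{α-n} dy`. -/
def Ialpha (n : ℕ) (a : ℝ) (f : (Fin n → ℝ) → ℝ) (x : Fin n → ℝ) : ℝ :=
  ∫ y, f y * Real.sqrt (∑ i, (x i - y i) ^ 2) ^ (a - (n : ℝ))

/-- The grand maximal truncation operator
`𝓜_{I_α,∞} f(x) = sup_{Q ∋ x} esssup_{y ∈ Q} |I_α(f χ_{ℝⁿ∖3Q})(y)|`. -/
def MIalpha (n : ℕ) (a : ℝ) (f : (Fin n → ℝ) → ℝ) (x : Fin n → ℝ) : ℝ≥0∞ :=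
  ⨆ (Q : Cube n) (_ : x ∈ Q.set),
    essSup (fun y => ENNReal.ofReal |Ialpha n a ((Q.three.set)ᶜ.indicator f) y|)
      (volume.restrict Q.set)

/-- Truncated kernel. -/
def kerT (n : ℕ) (a r : ℝ) : ℝ → ℝ := (Iio r).indicator (fun t => t ^ (a - (n : ℝ)))

lemma kerT_meas (n : ℕ) (a r : ℝ) : Measurable (kerT n a r) := by
  unfold kerT
  exact (measurable_id.pow_const _).indicator measurableSet_Iio

lemma kerT_nonneg (n : ℕ) (a r t : ℝ) (ht : 0 ≤ t) : 0 ≤ kerT n a r t := by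
  unfold kerT
  by_cases h : t ∈ Iio r
  · rw [indicator_of_mem h]; positivity
  · rw [indicator_of_notMem h]

lemma kerT_int (n : ℕ) (a : ℝ) (hn : 1 ≤ n) (ha : 0 < a) (r : ℝ) (hr : 0 < r) :
    ∫⁻ z : Fin n → ℝ, ENNReal.ofReal (kerT n a r ‖z‖) =
      ENNReal.ofReal (n * (volume.real (Metric.ball (0 : Fin n → ℝ) 1)) / a * r ^ a) := by
  haveI : Nonempty (Fin n) := ⟨⟨0, hn⟩⟩
  have hdim : Module.finrank ℝ (Fin n → ℝ) = n := by simp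
  have key : ∀ y ∈ Ioi (0:ℝ), y ^ (n - 1) • kerT n a r y =
      (Iio r).indicator (fun t => t ^ (a - 1)) y := by
    intro y hy
    unfold kerT
    by_cases h : y ∈ Iio r
    · rw [indicator_of_mem h, indicator_of_mem h, smul_eq_mul, ← Real.rpow_natCast,
        ← Real.rpow_add hy]
      congr 1
      push_cast [hn]
      ring
    · rw [indicator_of_notMem h, indicator_of_notMem h, smul_zero]
  have hset : Ioi (0:ℝ) ∩ Iio r = Ioo 0 r := rfl
  have hint : IntervalIntegrable (fun t : ℝ => t ^ (a - 1)) volume 0 r :=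
    intervalIntegral.intervalIntegrable_rpow' (by linarith)
  have hI : Integrable (fun z : Fin n → ℝ => kerT n a r ‖z‖) volume := by
    rw [integrable_fun_norm_addHaar volume, hdim]
    rw [integrableOn_congr_fun key measurableSet_Ioi, IntegrableOn,
      integrable_indicator_iff measurableSet_Iio, IntegrableOn,
      Measure.restrict_restrict measurableSet_Iio, inter_comm, hset]
    rw [intervalIntegrable_iff_integrableOn_Ioo_of_le hr.le] at hint
    exact hint
  rw [← ofReal_integral_eq_lintegral_ofReal hI
    (Filter.Eventually.of_forall fun z => kerT_nonneg _ _ _ _ (norm_nonneg _))]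
  congr 1
  rw [integral_fun_norm_addHaar volume, hdim, setIntegral_congr_fun measurableSet_Ioi key,
    setIntegral_indicator measurableSet_Iio, hset, ← integral_Ioc_eq_integral_Ioo,
    ← intervalIntegral.integral_of_le hr.le, integral_rpow (Or.inl (by linarith))]
  simp [Real.zero_rpow ha.ne']
  ring

lemma pt_bound (n : ℕ) (a : ℝ) (han : a < n) (Q : Cube n) (x y z : Fin n → ℝ)
    (hx : x ∈ Q.set) (hy : y ∈ Q.set) (hz : z ∉ Q.three.set) :
    Real.sqrt (∑ i, (y i - z i) ^ 2) ^ (a - (n : ℝ)) ≤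
      2 ^ ((n : ℝ) - a) * ‖x - z‖ ^ (a - (n : ℝ)) := by
  have hh := Q.h_pos
  simp only [Cube.set, Cube.three, mem_setOf_eq, not_forall] at hx hy hz
  set S := Real.sqrt (∑ i, (y i - z i) ^ 2) with hS
  have hc : ∀ i, |y i - z i| ≤ S := by
    intro i
    rw [← Real.sqrt_sq_eq_abs]
    exact Real.sqrt_le_sqrt
      (Finset.single_le_sum (f := fun i => (y i - z i) ^ 2) (fun j _ => sq_nonneg _)
        (Finset.mem_univ i))
  obtain ⟨i, hi⟩ := hz
  have hor : 2 * Q.h ≤ |y i - z i| ∧ 0 < |x i - z i| := by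
    have h1 := hx i
    have h2 := hy i
    by_cases h : Q.c i - 3 * Q.h ≤ z i
    · have h3 : Q.c i + 3 * Q.h ≤ z i := by
        by_contra h4
        exact hi ⟨h, not_le.mp h4⟩
      rw [abs_of_neg (by linarith), abs_of_neg (by linarith)]
      constructor <;> linarith
    · push Not at h
      rw [abs_of_pos (by linarith), abs_of_pos (by linarith)]
      constructor <;> linarith
  have hpos : 0 < ‖x - z‖ := lt_of_lt_of_le hor.2 (norm_le_pi_norm (x - z) i)
  have hle : ‖x - z‖ ≤ 2 * S := by
    rw [pi_norm_le_iff_of_nonneg (by positivity)]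
    intro j
    have h1 := hx j
    have h2 := hy j
    have h3 := hc j
    have h4 := hc i
    rw [Pi.sub_apply, Real.norm_eq_abs, abs_le]
    rw [abs_le] at h3
    constructor <;> linarith
  have e : 2 ^ ((n : ℝ) - a) * ‖x - z‖ ^ (a - (n : ℝ)) = (‖x - z‖ / 2) ^ (a - (n : ℝ)) := by
    rw [Real.div_rpow hpos.le (by norm_num), div_eq_mul_inv, ← Real.rpow_neg (by norm_num),
      neg_sub, mul_comm]
  rw [e]
  exact Real.rpow_le_rpow_of_nonpos (by positivity) (by linarith) (by linarith)

lemma M_le (n : ℕ) (a : ℝ) (han : a < n) (f : (Fin n → ℝ) → ℝ) (x : Fin n → ℝ) :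
    MIalpha n a f x ≤ ENNReal.ofReal (2 ^ ((n : ℝ) - a)) *
      ∫⁻ z, ENNReal.ofReal |f z| * ENNReal.ofReal (‖x - z‖ ^ (a - (n : ℝ))) := by
  unfold MIalpha
  refine iSup₂_le fun Q hx => ?_
  have hm : MeasurableSet Q.set := by
    have : Q.set = ⋂ i, {y : Fin n → ℝ | Q.c i - Q.h ≤ y i ∧ y i < Q.c i + Q.h} := by
      ext y; simp [Cube.set]
    rw [this]
    refine MeasurableSet.iInter fun i => ?_
    exact (measurableSet_le measurable_const (measurable_pi_apply i)).inter
      (measurableSet_lt (measurable_pi_apply i) measurable_const)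
  refine essSup_le_of_ae_le _ ?_
  filter_upwards [ae_restrict_mem hm] with y hy
  rw [← Real.norm_eq_abs, ofReal_norm, Ialpha]
  refine (enorm_integral_le_lintegral_enorm _).trans ?_
  rw [← lintegral_const_mul' _ _ ENNReal.ofReal_ne_top]
  refine lintegral_mono fun z => ?_
  by_cases hz : z ∈ Q.three.set
  · simp [hz]
  · have hz' : z ∈ (Q.three.set)ᶜ := hz
    simp only [indicator_of_mem hz']
    rw [← ofReal_norm, Real.norm_eq_abs, abs_mul, ← ENNReal.ofReal_mul (abs_nonneg _),
      ← ENNReal.ofReal_mul (by positivity)]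
    refine ENNReal.ofReal_le_ofReal ?_
    rw [abs_of_nonneg (by positivity : 0 ≤ Real.sqrt (∑ i, (y i - z i) ^ 2) ^ (a - (n : ℝ)))]
    calc _ ≤ |f z| * (2 ^ ((n : ℝ) - a) * ‖x - z‖ ^ (a - (n : ℝ))) := by
          gcongr
          exact pt_bound n a han Q x y z hx hy hz
      _ = _ := by ring

lemma J_weak (n : ℕ) (a : ℝ) (hn : 1 ≤ n) (ha : 0 < a) (han : a < n)
    (f : (Fin n → ℝ) → ℝ) (hf : Integrable f volume) (μ : ℝ) (hμ : 0 < μ) (F : ℝ) (hF0 : 0 < F)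
    (hF : ∫⁻ x, ENNReal.ofReal |f x| = ENNReal.ofReal F) :
    volume {x | ENNReal.ofReal μ <
        ∫⁻ z, ENNReal.ofReal |f z| * ENNReal.ofReal (‖x - z‖ ^ (a - (n : ℝ)))} ≤
      ENNReal.ofReal (n * (volume.real (Metric.ball (0 : Fin n → ℝ) 1)) / a *
        (2 * F / μ) ^ ((n : ℝ) / ((n : ℝ) - a))) := by
  have hna : 0 < (n : ℝ) - a := by linarith
  set A := n * (volume.real (Metric.ball (0 : Fin n → ℝ) 1)) / a with hA
  have hA0 : 0 ≤ A := by positivity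
  set r := (2 * F / μ) ^ (1 / ((n : ℝ) - a)) with hr
  have hb : 0 < 2 * F / μ := by positivity
  have hr0 : 0 < r := by positivity
  have hr1 : r ^ ((n : ℝ) - a) = 2 * F / μ := by
    rw [hr, ← Real.rpow_mul hb.le, one_div_mul_cancel hna.ne', Real.rpow_one]
  have hr2 : r ^ (n : ℝ) = (2 * F / μ) ^ ((n : ℝ) / ((n : ℝ) - a)) := by
    rw [hr, ← Real.rpow_mul hb.le]; congr 1; ring
  have hr3 : r ^ (a - (n : ℝ)) = μ / (2 * F) := by
    rw [← neg_sub, Real.rpow_neg hr0.le, hr1, inv_div]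
  have hfm : AEMeasurable (fun z => ENNReal.ofReal |f z|) volume := by
    have := hf.aestronglyMeasurable.aemeasurable
    exact (this.norm).ennreal_ofReal
  have hkm : Measurable (fun p : (Fin n → ℝ) × (Fin n → ℝ) =>
      ENNReal.ofReal (kerT n a r ‖p.1 - p.2‖)) :=
    ((kerT_meas n a r).comp (measurable_fst.sub measurable_snd).norm).ennreal_ofReal
  have hjm : AEMeasurable (fun p : (Fin n → ℝ) × (Fin n → ℝ) =>
      ENNReal.ofReal |f p.2| * ENNReal.ofReal (kerT n a r ‖p.1 - p.2‖))
      (volume.prod volume) :=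
    (hfm.comp_quasiMeasurePreserving Measure.quasiMeasurePreserving_snd).mul hkm.aemeasurable
  set J1 : (Fin n → ℝ) → ℝ≥0∞ := fun x =>
    ∫⁻ z, ENNReal.ofReal |f z| * ENNReal.ofReal (kerT n a r ‖x - z‖) with hJ1
  have hJm : AEMeasurable J1 volume := hjm.lintegral_prod_right'
  have hJint : ∫⁻ x, J1 x = ENNReal.ofReal F * ENNReal.ofReal (A * r ^ a) := by
    rw [hJ1, lintegral_lintegral_swap hjm]
    have : ∀ z, ∫⁻ x, ENNReal.ofReal |f z| * ENNReal.ofReal (kerT n a r ‖x - z‖) =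
        ENNReal.ofReal |f z| * ENNReal.ofReal (A * r ^ a) := by
      intro z
      rw [lintegral_const_mul' _ _ ENNReal.ofReal_ne_top,
        lintegral_sub_right_eq_self (fun x => ENNReal.ofReal (kerT n a r ‖x‖)) z,
        kerT_int n a hn ha r hr0]
    simp_rw [this]
    rw [lintegral_mul_const' _ _ ENNReal.ofReal_ne_top, hF]
  have hsub : {x | ENNReal.ofReal μ <
        ∫⁻ z, ENNReal.ofReal |f z| * ENNReal.ofReal (‖x - z‖ ^ (a - (n : ℝ)))} ⊆
      {x | ENNReal.ofReal (μ / 2) ≤ J1 x} := by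
    intro x hx
    simp only [mem_setOf_eq] at hx ⊢
    have hle : ∫⁻ z, ENNReal.ofReal |f z| * ENNReal.ofReal (‖x - z‖ ^ (a - (n : ℝ))) ≤
        J1 x + ENNReal.ofReal (μ / 2) := by
      have e2 : ENNReal.ofReal (μ / 2) =
          ∫⁻ z, ENNReal.ofReal |f z| * ENNReal.ofReal (μ / (2 * F)) := by
        rw [lintegral_mul_const' _ _ ENNReal.ofReal_ne_top, hF, ← ENNReal.ofReal_mul hF0.le]
        congr 1; field_simp
      rw [e2, hJ1, ← lintegral_add_right' _ (hfm.mul_const _)]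
      refine lintegral_mono fun z => ?_
      dsimp only
      rw [← mul_add]
      gcongr
      by_cases h : ‖x - z‖ ∈ Iio r
      · rw [kerT, indicator_of_mem h]
        exact le_self_add
      · rw [← hr3]
        refine le_add_left (ENNReal.ofReal_le_ofReal ?_)
        exact Real.rpow_le_rpow_of_nonpos hr0 (not_lt.mp h) (by linarith)
    by_contra hlt
    push Not at hlt
    have h3 := hx.trans_le hle
    have h4 : J1 x + ENNReal.ofReal (μ / 2) ≤ ENNReal.ofReal (μ / 2) + ENNReal.ofReal (μ / 2) := by
      gcongr
    rw [← ENNReal.ofReal_add (by positivity) (by positivity), add_halves] at h4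
    exact absurd (h3.trans_le h4) (lt_irrefl _)
  refine (measure_mono hsub).trans ((meas_ge_le_lintegral_div hJm (by simpa using hμ)
    ENNReal.ofReal_ne_top).trans (le_of_eq ?_))
  rw [hJint, ← ENNReal.ofReal_mul hF0.le, ← ENNReal.ofReal_div_of_pos (by positivity), ← hr2]
  congr 1
  have : r ^ (n : ℝ) = r ^ ((n : ℝ) - a) * r ^ a := by
    rw [← Real.rpow_add hr0]; congr 1; ring
  rw [this, hr1]
  field_simp

/-- **Endpoint weak-type `L¹ → L^{n/(n-α),∞}` bound for the grand maximal truncation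
operator of `I_α`.** -/
theorem MIalpha_weak_type (n : ℕ) (a : ℝ) (hn : 1 ≤ n) (ha : 0 < a) (han : a < n) :
    ∃ C : ℝ≥0∞, 0 < C ∧ C < ∞ ∧
      ∀ f : (Fin n → ℝ) → ℝ, Integrable f volume →
        ∀ lam : ℝ, 0 < lam →
          volume {x | ENNReal.ofReal lam < MIalpha n a f x} ≤
            C * ((∫⁻ x, ENNReal.ofReal |f x|) / ENNReal.ofReal lam) ^
              ((n : ℝ) / ((n : ℝ) - a)) := by
  haveI : Nonempty (Fin n) := ⟨⟨0, hn⟩⟩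
  have hna : 0 < (n : ℝ) - a := by linarith
  set A := n * (volume.real (Metric.ball (0 : Fin n → ℝ) 1)) / a with hA
  have hn0 : (0 : ℝ) < n := by linarith
  have hA0 : 0 < A := by
    have : 0 < volume.real (Metric.ball (0 : Fin n → ℝ) 1) :=
      ENNReal.toReal_pos (Metric.measure_ball_pos _ _ one_pos).ne' measure_ball_lt_top.ne
    positivity
  set K : ℝ := 2 ^ ((n : ℝ) - a) with hK
  have hK0 : 0 < K := by positivity
  set s := (n : ℝ) / ((n : ℝ) - a) with hs
  have hs0 : 0 < s := by positivity
  refine ⟨ENNReal.ofReal (A * (2 * K) ^ s), by simp only [ENNReal.ofReal_pos]; positivity,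
    ENNReal.ofReal_lt_top, fun f hf lam hlam => ?_⟩
  have hsub : {x | ENNReal.ofReal lam < MIalpha n a f x} ⊆ {x | ENNReal.ofReal (lam / K) <
        ∫⁻ z, ENNReal.ofReal |f z| * ENNReal.ofReal (‖x - z‖ ^ (a - (n : ℝ)))} := by
    intro x hx
    simp only [mem_setOf_eq] at hx ⊢
    have h := hx.trans_le (M_le n a han f x)
    rw [ENNReal.ofReal_div_of_pos hK0]
    exact ENNReal.div_lt_of_lt_mul' h
  refine (measure_mono hsub).trans ?_
  have hfin : ∫⁻ x, ENNReal.ofReal |f x| ≠ ∞ := by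
    have := hf.2.ne
    simp_rw [← ofReal_norm, Real.norm_eq_abs] at this
    exact this
  by_cases h0 : ∫⁻ x, ENNReal.ofReal |f x| = 0
  · have hz : ∀ x : Fin n → ℝ, ∫⁻ z, ENNReal.ofReal |f z| *
        ENNReal.ofReal (‖x - z‖ ^ (a - (n : ℝ))) = 0 := by
      intro x
      have hfm : AEMeasurable (fun z => ENNReal.ofReal |f z|) volume :=
        (hf.aestronglyMeasurable.aemeasurable.norm).ennreal_ofReal
      rw [lintegral_eq_zero_iff' hfm] at h0
      rw [← lintegral_zero (μ := (volume : Measure (Fin n → ℝ)))]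
      refine lintegral_congr_ae ?_
      filter_upwards [h0] with z hz
      simp only [Pi.zero_apply] at hz
      rw [hz, zero_mul]
    simp [hz]
  · have hF0 := ENNReal.toReal_pos h0 hfin
    have hF := (ENNReal.ofReal_toReal hfin).symm
    set F := (∫⁻ x, ENNReal.ofReal |f x|).toReal with hFdef
    refine (J_weak n a hn ha han f hf (lam / K) (by positivity) F hF0 hF).trans (le_of_eq ?_)
    rw [hF, ← ENNReal.ofReal_div_of_pos hlam, ENNReal.ofReal_rpow_of_pos (by positivity),
      ← ENNReal.ofReal_mul (by positivity)]
    congr 1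
    rw [mul_assoc, ← Real.mul_rpow (by positivity) (by positivity)]
    congr 2
    field_simp

end Frac
end
end
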